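/- There exists D > 0 depending only on C₀ such that the following holds: if ε, β > 0 satisfy β ≤ D²ε⁴ and u is an admissible solution of (★★) whose initial datum satisfies ‖u(0,·)‖²_{L²(ℝ)} + ‖u(0,·)‖⁴_{L⁴(ℝ)} + βε²‖∂_x² u(0,·)‖²_{L²(ℝ)} ≤ C₀ as well as ‖u(0,·)‖²_{L²(ℝ)} + β‖∂_x u(0,·)‖²_{L²(ℝ)} + β²‖∂_x² u(0,·)‖²_{L²(ℝ)} ≤ C₀, then there is a constant C depending only on C₀ such that for every t > 0: β^{1/2} ε ‖∂_x² u(t,·)‖_{L²(ℝ)} ≤ C. -/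

import Mathlib

open MeasureTheory Real Filter Set

noncomputable section

/-- `mixedD u j k t x`: `j` time derivatives of the `k`-th spatial derivative of `u` at `(t,x)`. -/
def mixedD (u : ℝ → ℝ → ℝ) (j k : ℕ) (t x : ℝ) : ℝ :=
  iteratedDeriv j (fun s => iteratedDeriv k (fun y => u s y) x) t

/-- Squared `L²` norm in the space variable. -/
def sqL2 (f : ℝ → ℝ) : ℝ := ∫ x : ℝ, (f x) ^ 2

/-- `L²` norm in the space variable. -/
def nL2 (f : ℝ → ℝ) : ℝ := Real.sqrt (∫ x : ℝ, (f x) ^ 2)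

/-- `L⁴` norm in the space variable. -/
def nL4 (f : ℝ → ℝ) : ℝ := (∫ x : ℝ, (f x) ^ 4) ^ ((1 : ℝ) / 4)

/-- Admissible solution of the Rosenau–KdV–RLW approximation (★). -/
structure IsAdmissibleKdVRLW (ε β : ℝ) (u : ℝ → ℝ → ℝ) : Prop where
  smooth : ContDiff ℝ (⊤ : ℕ∞) (fun p : ℝ × ℝ => u p.1 p.2)
  pde : ∀ t > (0 : ℝ), ∀ x : ℝ,
    mixedD u 1 0 t x + deriv (fun y => (u t y) ^ 2) x
      + β * mixedD u 0 3 t x - β * mixedD u 1 2 t x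
      + β ^ 2 * mixedD u 1 4 t x = ε * mixedD u 0 2 t x
  sq_int : ∀ T > (0 : ℝ), ∀ j k : ℕ, j + k ≤ 5 → ∀ t ∈ Set.Icc (0 : ℝ) T,
    MeasureTheory.Integrable (fun x : ℝ => (mixedD u j k t x) ^ 2)
  decay : ∀ T > (0 : ℝ), ∀ j k : ℕ, j + k ≤ 5 → ∀ δ > (0 : ℝ), ∃ M : ℝ,
    ∀ x : ℝ, M ≤ |x| → ∀ t ∈ Set.Icc (0 : ℝ) T, |mixedD u j k t x| ≤ δ

/-- Admissible solution of the Rosenau–RLW approximation (★★). -/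
structure IsAdmissibleRLW (ε β : ℝ) (u : ℝ → ℝ → ℝ) : Prop where
  smooth : ContDiff ℝ (⊤ : ℕ∞) (fun p : ℝ × ℝ => u p.1 p.2)
  pde : ∀ t > (0 : ℝ), ∀ x : ℝ,
    mixedD u 1 0 t x + deriv (fun y => (u t y) ^ 2) x
      - β * mixedD u 1 2 t x + β ^ 2 * mixedD u 1 4 t x = ε * mixedD u 0 2 t x
  sq_int : ∀ T > (0 : ℝ), ∀ j k : ℕ, j + k ≤ 5 → ∀ t ∈ Set.Icc (0 : ℝ) T,
    MeasureTheory.Integrable (fun x : ℝ => (mixedD u j k t x) ^ 2)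
  decay : ∀ T > (0 : ℝ), ∀ j k : ℕ, j + k ≤ 5 → ∀ δ > (0 : ℝ), ∃ M : ℝ,
    ∀ x : ℝ, M ≤ |x| → ∀ t ∈ Set.Icc (0 : ℝ) T, |mixedD u j k t x| ≤ δ

/-- Data bounds with constant `C0` for the (★) approximation. -/
def DataBoundsKdVRLW (ε β C0 : ℝ) (f : ℝ → ℝ) : Prop :=
  (∫ x : ℝ, (f x) ^ 2) + (∫ x : ℝ, (f x) ^ 4)
      + (β + ε ^ 2) * (∫ x : ℝ, (deriv f x) ^ 2) ≤ C0 ∧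
  (β * ε + β * ε ^ 2 + β ^ 2) * (∫ x : ℝ, (iteratedDeriv 2 f x) ^ 2)
      + (β ^ 2 * ε ^ 2 + β ^ 3) * (∫ x : ℝ, (iteratedDeriv 3 f x) ^ 2) ≤ C0 ∧
  β ^ 4 * (∫ x : ℝ, (iteratedDeriv 4 f x) ^ 2) ≤ C0

/-- Data bounds with constant `C0` for the (★★) approximation. -/
def DataBoundsRLW (ε β C0 : ℝ) (f : ℝ → ℝ) : Prop :=
  (∫ x : ℝ, (f x) ^ 2) + (∫ x : ℝ, (f x) ^ 4)
    + β * ε ^ 2 * (∫ x : ℝ, (iteratedDeriv 2 f x) ^ 2) ≤ C0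

/-- `u ∈ L^∞((0,∞); L²(ℝ) ∩ L⁴(ℝ))`. -/
def BddL2L4 (u : ℝ → ℝ → ℝ) : Prop :=
  ∃ M : ℝ, ∀ t > (0 : ℝ), (∫ x : ℝ, (u t x) ^ 2) ≤ M ∧ (∫ x : ℝ, (u t x) ^ 4) ≤ M

/-- Entropy solution of `∂ₜ u + ∂ₓ (u²) = 0` with initial datum `u0`. -/
def IsEntropySolution (u : ℝ → ℝ → ℝ) (u0 : ℝ → ℝ) : Prop :=
  ∀ η : ℝ → ℝ, ContDiff ℝ 2 η → ConvexOn ℝ Set.univ η →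
    (∃ M : ℝ, ∀ v : ℝ, |deriv η v| ≤ M) →
    ∀ φ : ℝ → ℝ → ℝ, ContDiff ℝ (⊤ : ℕ∞) (fun p : ℝ × ℝ => φ p.1 p.2) →
      HasCompactSupport (fun p : ℝ × ℝ => φ p.1 p.2) →
      (∀ t x : ℝ, 0 ≤ φ t x) →
      0 ≤ (∫ t in Set.Ioi (0 : ℝ), ∫ x : ℝ,
            (η (u t x) * deriv (fun s => φ s x) t
              + (∫ ξ in (0 : ℝ)..(u t x), 2 * ξ * deriv η ξ) * deriv (fun y => φ t y) x))
          + ∫ x : ℝ, η (u0 x) * φ 0 x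

/-- Partial derivative of `f` in the direction `v`. -/
def dirD (v : ℝ × ℝ) (f : ℝ × ℝ → ℝ) (p : ℝ × ℝ) : ℝ := fderiv ℝ f p v

lemma contDiff_dirD (v : ℝ × ℝ) {f : ℝ × ℝ → ℝ} (hf : ContDiff ℝ (⊤ : ℕ∞) f) :
    ContDiff ℝ (⊤ : ℕ∞) (dirD v f) :=
  (hf.fderiv_right (m := (⊤ : ℕ∞)) (by simp)).clm_apply contDiff_const

lemma contDiff_dirD_iterate (v : ℝ × ℝ) {f : ℝ × ℝ → ℝ} (hf : ContDiff ℝ (⊤ : ℕ∞) f) (n : ℕ) :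
    ContDiff ℝ (⊤ : ℕ∞) ((dirD v)^[n] f) := by
  induction n with
  | zero => exact hf
  | succ n ih => rw [Function.iterate_succ_apply']; exact contDiff_dirD v ih

lemma dirD_comm (v w : ℝ × ℝ) {f : ℝ × ℝ → ℝ} (hf : ContDiff ℝ (⊤ : ℕ∞) f) :
    dirD v (dirD w f) = dirD w (dirD v f) := by
  have key : ∀ (a b p : ℝ × ℝ), dirD a (dirD b f) p = fderiv ℝ (fderiv ℝ f) p a b := by
    intro a b p
    have hd : DifferentiableAt ℝ (fderiv ℝ f) p :=
      (hf.fderiv_right (m := 1) (by norm_cast)).differentiable one_ne_zero p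
    have := (hd.hasFDerivAt.clm_apply (hasFDerivAt_const b p)).fderiv
    unfold dirD
    rw [this]
    simp
  funext p
  rw [key, key]
  exact (hf.contDiffAt.isSymmSndFDerivAt (by simp; norm_cast)) v w

lemma dirD_iterate_comm (v w : ℝ × ℝ) {f : ℝ × ℝ → ℝ} (hf : ContDiff ℝ (⊤ : ℕ∞) f) (n : ℕ) :
    dirD v ((dirD w)^[n] f) = (dirD w)^[n] (dirD v f) := by
  induction n with
  | zero => rfl
  | succ n ih =>
    rw [Function.iterate_succ_apply', Function.iterate_succ_apply',
      dirD_comm v w (contDiff_dirD_iterate w hf n), ih]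

lemma hasDerivAt_fst_dirD {f : ℝ × ℝ → ℝ} {t x : ℝ} (hf : DifferentiableAt ℝ f (t, x)) :
    HasDerivAt (fun s => f (s, x)) (dirD (1, 0) f (t, x)) t :=
  hf.hasFDerivAt.comp_hasDerivAt t ((hasDerivAt_id t).prodMk (hasDerivAt_const t x))

lemma hasDerivAt_snd_dirD {f : ℝ × ℝ → ℝ} {t x : ℝ} (hf : DifferentiableAt ℝ f (t, x)) :
    HasDerivAt (fun y => f (t, y)) (dirD (0, 1) f (t, x)) x :=
  hf.hasFDerivAt.comp_hasDerivAt x ((hasDerivAt_const x t).prodMk (hasDerivAt_id x))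

lemma ContDiff.differentiableAt_of_top {f : ℝ × ℝ → ℝ} (hf : ContDiff ℝ (⊤ : ℕ∞) f)
    (p : ℝ × ℝ) : DifferentiableAt ℝ f p :=
  hf.differentiable (by simp) p

lemma iteratedDeriv_fst_eq_dirD {f : ℝ × ℝ → ℝ} (hf : ContDiff ℝ (⊤ : ℕ∞) f) (n : ℕ) (t x : ℝ) :
    iteratedDeriv n (fun s => f (s, x)) t = (dirD (1, 0))^[n] f (t, x) := by
  induction n generalizing t with
  | zero => simp
  | succ n ih =>
    rw [iteratedDeriv_succ, Function.iterate_succ_apply', funext ih]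
    exact (hasDerivAt_fst_dirD
      ((contDiff_dirD_iterate _ hf n).differentiableAt_of_top _)).deriv

lemma iteratedDeriv_snd_eq_dirD {f : ℝ × ℝ → ℝ} (hf : ContDiff ℝ (⊤ : ℕ∞) f) (n : ℕ) (t x : ℝ) :
    iteratedDeriv n (fun y => f (t, y)) x = (dirD (0, 1))^[n] f (t, x) := by
  induction n generalizing x with
  | zero => simp
  | succ n ih =>
    rw [iteratedDeriv_succ, Function.iterate_succ_apply', funext ih]
    exact (hasDerivAt_snd_dirD
      ((contDiff_dirD_iterate _ hf n).differentiableAt_of_top _)).deriv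

lemma mixedD_eq_dirD {u : ℝ → ℝ → ℝ} (hu : ContDiff ℝ (⊤ : ℕ∞) (fun p : ℝ × ℝ => u p.1 p.2))
    (j k : ℕ) (t x : ℝ) :
    mixedD u j k t x =
      (dirD (1, 0))^[j] ((dirD (0, 1))^[k] (fun p : ℝ × ℝ => u p.1 p.2)) (t, x) := by
  rw [← iteratedDeriv_fst_eq_dirD (contDiff_dirD_iterate _ hu k)]
  simp only [← iteratedDeriv_snd_eq_dirD hu]
  rfl

lemma contDiff_mixedD {u : ℝ → ℝ → ℝ} (hu : ContDiff ℝ (⊤ : ℕ∞) (fun p : ℝ × ℝ => u p.1 p.2))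
    (j k : ℕ) : ContDiff ℝ (⊤ : ℕ∞) (fun p : ℝ × ℝ => mixedD u j k p.1 p.2) := by
  simp only [mixedD_eq_dirD hu]
  exact contDiff_dirD_iterate _ (contDiff_dirD_iterate _ hu k) j

lemma hasDerivAt_mixedD_time {u : ℝ → ℝ → ℝ}
    (hu : ContDiff ℝ (⊤ : ℕ∞) (fun p : ℝ × ℝ => u p.1 p.2)) (j k : ℕ) (t x : ℝ) :
    HasDerivAt (fun s => mixedD u j k s x) (mixedD u (j + 1) k t x) t := by
  simp only [mixedD_eq_dirD hu]
  rw [Function.iterate_succ_apply']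
  exact hasDerivAt_fst_dirD
    ((contDiff_dirD_iterate _ (contDiff_dirD_iterate _ hu k) j).differentiableAt_of_top _)

lemma hasDerivAt_mixedD_space {u : ℝ → ℝ → ℝ}
    (hu : ContDiff ℝ (⊤ : ℕ∞) (fun p : ℝ × ℝ => u p.1 p.2)) (j k : ℕ) (t x : ℝ) :
    HasDerivAt (fun y => mixedD u j k t y) (mixedD u j (k + 1) t x) x := by
  simp only [mixedD_eq_dirD hu]
  rw [Function.iterate_succ_apply', ← dirD_iterate_comm _ _ (contDiff_dirD_iterate _ hu k)]
  exact hasDerivAt_snd_dirD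
    ((contDiff_dirD_iterate _ (contDiff_dirD_iterate _ hu k) j).differentiableAt_of_top _)

lemma continuous_mixedD_space {u : ℝ → ℝ → ℝ}
    (hu : ContDiff ℝ (⊤ : ℕ∞) (fun p : ℝ × ℝ => u p.1 p.2)) (j k : ℕ) (t : ℝ) :
    Continuous (mixedD u j k t) :=
  continuous_iff_continuousAt.2 fun x => (hasDerivAt_mixedD_space hu j k t x).continuousAt

lemma eventually_principal_prod_iff {α γ : Type*} {s : Set α} {l : Filter γ}
    {P : α × γ → Prop} :
    (∀ᶠ p in 𝓟 s ×ˢ l, P p) ↔ ∀ᶠ y in l, ∀ a ∈ s, P (a, y) := by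
  rw [eventually_swap_iff, eventually_prod_principal_iff]
  rfl

lemma tendsto_intervalIntegral_zero_of_tendsto_prod {q : ℝ × ℝ → ℝ} {T : ℝ} (hT : 0 ≤ T)
    (hq : Tendsto q (𝓟 (Icc 0 T) ×ˢ cocompact ℝ) (nhds 0)) {l : Filter ℝ}
    (hl : l ≤ cocompact ℝ) :
    Tendsto (fun x => ∫ t in (0 : ℝ)..T, q (t, x)) l (nhds 0) := by
  rw [Metric.tendsto_nhds]
  intro δ hδ
  have hδ' : 0 < δ / (T + 1) := by positivity
  have h := (Metric.tendsto_nhds.1 hq) _ hδ'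
  rw [eventually_principal_prod_iff] at h
  filter_upwards [hl h] with x hx
  have hb : ∀ t ∈ uIoc 0 T, ‖q (t, x)‖ ≤ δ / (T + 1) := by
    intro t ht
    rw [uIoc_of_le hT] at ht
    simpa using (hx t (Ioc_subset_Icc_self ht)).le
  have := intervalIntegral.norm_integral_le_of_norm_le_const hb
  rw [dist_zero_right]
  refine this.trans_lt ?_
  rw [sub_zero, abs_of_nonneg hT, div_mul_eq_mul_div, div_lt_iff₀ (by positivity)]
  nlinarith

/-- If `∂ₜ e + ∂ₓ q ≤ 0` and the flux `q` vanishes at spatial infinity uniformly in time,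
then `∫ e(t, ·)` does not increase. -/
lemma integral_le_of_divergence_nonpos {e q : ℝ × ℝ → ℝ} (he : ContDiff ℝ (⊤ : ℕ∞) e)
    (hq : ContDiff ℝ (⊤ : ℕ∞) q) {T : ℝ} (hT : 0 ≤ T)
    (hdecay : Tendsto q (𝓟 (Icc 0 T) ×ˢ cocompact ℝ) (nhds 0))
    (hdiv : ∀ t > (0 : ℝ), t ≤ T → ∀ x, ∃ e' q', HasDerivAt (fun s => e (s, x)) e' t ∧
      HasDerivAt (fun y => q (t, y)) q' x ∧ e' + q' ≤ 0)
    (hi0 : Integrable (fun x => e (0, x))) (hiT : Integrable (fun x => e (T, x))) :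
    ∫ x, e (T, x) ≤ ∫ x, e (0, x) := by
  have hcont : Continuous (fun p : ℝ × ℝ => fderiv ℝ e p (1, 0) + fderiv ℝ q p (0, 1)) :=
    (contDiff_dirD (1, 0) he).continuous.add (contDiff_dirD (0, 1) hq).continuous
  have hfin : ∀ R : ℝ, 0 ≤ R →
      (∫ t in (0 : ℝ)..T, q (t, R)) - (∫ t in (0 : ℝ)..T, q (t, -R))
        + (∫ x in (-R)..R, e (T, x)) - (∫ x in (-R)..R, e (0, x)) ≤ 0 := by
    intro R hR
    have hdivthm := integral2_divergence_prod_of_hasFDerivAt_off_countable e q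
      (fderiv ℝ e) (fderiv ℝ q) 0 (-R) T R ∅ countable_empty
      he.continuous.continuousOn hq.continuous.continuousOn
      (fun p _ => (he.differentiableAt_of_top p).hasFDerivAt)
      (fun p _ => (hq.differentiableAt_of_top p).hasFDerivAt)
      (hcont.continuousOn.integrableOn_compact (isCompact_uIcc.prod isCompact_uIcc))
    rw [← hdivthm, intervalIntegral.integral_of_le hT]
    refine setIntegral_nonpos measurableSet_Ioc fun t ht => ?_
    rw [intervalIntegral.integral_of_le (by linarith)]
    refine setIntegral_nonpos measurableSet_Ioc fun x _ => ?_
    obtain ⟨e', q', h1, h2, h3⟩ := hdiv t ht.1 ht.2 x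
    rw [h1.unique (hasDerivAt_fst_dirD (he.differentiableAt_of_top (t, x))),
      h2.unique (hasDerivAt_snd_dirD (hq.differentiableAt_of_top (t, x)))] at h3
    exact h3
  have hlim := (((tendsto_intervalIntegral_zero_of_tendsto_prod hT hdecay
      atTop_le_cocompact).sub
    ((tendsto_intervalIntegral_zero_of_tendsto_prod hT hdecay
      atBot_le_cocompact).comp tendsto_neg_atTop_atBot)).add
    (intervalIntegral_tendsto_integral hiT tendsto_neg_atTop_atBot tendsto_id)).sub
    (intervalIntegral_tendsto_integral hi0 tendsto_neg_atTop_atBot tendsto_id)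
  have := le_of_tendsto hlim ((eventually_ge_atTop (0 : ℝ)).mono hfin)
  linarith

/-- One-dimensional weighted Sobolev bound. -/
lemma mul_sq_le_integral_of_hasDerivAt {f f' : ℝ → ℝ} (hf : ∀ x, HasDerivAt f (f' x) x)
    (hc : Continuous f') (hi : Integrable (fun x => f x ^ 2))
    (hi' : Integrable (fun x => f' x ^ 2)) (hlim : Tendsto f atBot (nhds 0)) (r x : ℝ) :
    r * f x ^ 2 ≤ (∫ y, f y ^ 2) + r ^ 2 * ∫ y, f' y ^ 2 := by
  have hcf : Continuous f := continuous_iff_continuousAt.2 fun y => (hf y).continuousAt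
  have hg : Integrable (fun y => f y ^ 2 + r ^ 2 * f' y ^ 2) := hi.add (hi'.const_mul _)
  have hprod : Integrable (fun y => 2 * r * (f y * f' y)) := by
    refine hg.mono' (by fun_prop) (Eventually.of_forall fun y => ?_)
    rw [Real.norm_eq_abs, abs_le]
    constructor <;> nlinarith [sq_nonneg (f y - r * f' y), sq_nonneg (f y + r * f' y)]
  have hd : ∀ y ∈ Iic x, HasDerivAt (fun y => r * f y ^ 2) (2 * r * (f y * f' y)) y := by
    intro y _
    exact (((hf y).pow 2).const_mul r).congr_deriv (by push_cast; ring)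
  have hl : Tendsto (fun y => r * f y ^ 2) atBot (nhds 0) := by
    simpa using (hlim.pow 2).const_mul r
  have h := integral_Iic_of_hasDerivAt_of_tendsto' hd hprod.integrableOn hl
  have hmono : ∫ y in Iic x, 2 * r * (f y * f' y) ≤
      ∫ y in Iic x, (f y ^ 2 + r ^ 2 * f' y ^ 2) :=
    integral_mono hprod.integrableOn hg.integrableOn fun y => by
      nlinarith [sq_nonneg (f y - r * f' y)]
  have hset : ∫ y in Iic x, (f y ^ 2 + r ^ 2 * f' y ^ 2) ≤ ∫ y, (f y ^ 2 + r ^ 2 * f' y ^ 2) :=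
    setIntegral_le_integral hg (Eventually.of_forall fun y => by positivity)
  rw [integral_add hi (hi'.const_mul _), integral_const_mul] at hset
  linarith

/-- Sign of the dissipation in the combined `L⁴`–`H²` balance. -/
lemma dissipation_nonpos {ε β a b r s w : ℝ} (hε : 0 < ε) (hβ : 0 < β)
    (ha : β * a ^ 2 ≤ ε ^ 2 / 8) :
    -12 * β * a ^ 2 * b * r + 12 * β ^ 2 * a ^ 2 * b * w - 12 * ε * a ^ 2 * b ^ 2
      - 2 * β * ε * r ^ 2 + 4 * β * ε * a * b * s - 2 * β ^ 2 * ε * s ^ 2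
      - 2 * β ^ 3 * ε * w ^ 2 ≤ 0 := by
  refine nonpos_of_mul_nonpos_right (a := ε) ?_ hε
  have h1 : 0 ≤ β * r ^ 2 * (2 * ε ^ 2 - 9 * (β * a ^ 2)) :=
    mul_nonneg (by positivity) (by nlinarith)
  have h2 : 0 ≤ β ^ 3 * w ^ 2 * (2 * ε ^ 2 - 9 * (β * a ^ 2)) :=
    mul_nonneg (by positivity) (by nlinarith)
  nlinarith [sq_nonneg (2 * ε * (a * b) + 3 * β * a * r),
    sq_nonneg (2 * ε * (a * b) - 3 * β ^ 2 * a * w), sq_nonneg (ε * (a * b) - β * ε * s),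
    sq_nonneg (ε * (a * b))]

namespace IsAdmissibleRLW

variable {ε β : ℝ} {u : ℝ → ℝ → ℝ}

lemma tendsto_mixedD (h : IsAdmissibleRLW ε β u) {T : ℝ} (hT : 0 < T) {j k : ℕ}
    (hjk : j + k ≤ 5) :
    Tendsto (fun p : ℝ × ℝ => mixedD u j k p.1 p.2) (𝓟 (Icc 0 T) ×ˢ cocompact ℝ) (nhds 0) := by
  rw [Metric.tendsto_nhds]
  intro δ hδ
  obtain ⟨M, hM⟩ := h.decay T hT j k hjk (δ / 2) (by positivity)
  rw [eventually_principal_prod_iff]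
  filter_upwards [tendsto_norm_cocompact_atTop.eventually_ge_atTop M] with x hx t ht
  rw [dist_zero_right]
  have := hM x hx t ht
  rw [Real.norm_eq_abs]
  linarith

lemma integrable_sq (h : IsAdmissibleRLW ε β u) {t : ℝ} (ht : 0 ≤ t) {j k : ℕ}
    (hjk : j + k ≤ 5) : Integrable (fun x => mixedD u j k t x ^ 2) :=
  h.sq_int (t + 1) (by linarith) j k hjk t ⟨ht, by linarith⟩

lemma pde_mixedD (h : IsAdmissibleRLW ε β u) {t : ℝ} (ht : 0 < t) (x : ℝ) :
    mixedD u 1 0 t x + 2 * mixedD u 0 0 t x * mixedD u 0 1 t x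
      - β * mixedD u 1 2 t x + β ^ 2 * mixedD u 1 4 t x = ε * mixedD u 0 2 t x := by
  have hd := (hasDerivAt_mixedD_space h.smooth 0 0 t x).pow 2
  have hu : (fun y => mixedD u 0 0 t y) ^ 2 = fun y => u t y ^ 2 := by
    funext y; simp [mixedD]
  rw [hu] at hd
  have := h.pde t ht x
  rw [hd.deriv] at this
  simpa using this

lemma energy_le (h : IsAdmissibleRLW ε β u) (hε : 0 < ε) {t : ℝ} (ht : 0 < t) :
    ∫ x, (mixedD u 0 0 t x ^ 2 + β * mixedD u 0 1 t x ^ 2 + β ^ 2 * mixedD u 0 2 t x ^ 2) ≤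
      ∫ x, (mixedD u 0 0 0 x ^ 2 + β * mixedD u 0 1 0 x ^ 2 + β ^ 2 * mixedD u 0 2 0 x ^ 2) := by
  have hs := contDiff_mixedD h.smooth
  have hi : ∀ s : ℝ, 0 ≤ s → Integrable (fun x => mixedD u 0 0 s x ^ 2
      + β * mixedD u 0 1 s x ^ 2 + β ^ 2 * mixedD u 0 2 s x ^ 2) := fun s hs =>
    ((h.integrable_sq hs (by simp)).add ((h.integrable_sq hs (by simp)).const_mul β)).add
      ((h.integrable_sq hs (by simp)).const_mul (β ^ 2))
  refine integral_le_of_divergence_nonpos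
    (e := fun p => mixedD u 0 0 p.1 p.2 ^ 2 + β * mixedD u 0 1 p.1 p.2 ^ 2
      + β ^ 2 * mixedD u 0 2 p.1 p.2 ^ 2)
    (q := fun p => 4 / 3 * mixedD u 0 0 p.1 p.2 ^ 3
      - 2 * β * (mixedD u 0 0 p.1 p.2 * mixedD u 1 1 p.1 p.2)
      + 2 * β ^ 2 * (mixedD u 0 0 p.1 p.2 * mixedD u 1 3 p.1 p.2
        - mixedD u 0 1 p.1 p.2 * mixedD u 1 2 p.1 p.2)
      - 2 * ε * (mixedD u 0 0 p.1 p.2 * mixedD u 0 1 p.1 p.2))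
    ?_ ?_ ht.le ?_ ?_ (hi 0 le_rfl) (hi t ht.le)
  · exact (((hs 0 0).pow 2).add (contDiff_const.mul ((hs 0 1).pow 2))).add
      (contDiff_const.mul ((hs 0 2).pow 2))
  · exact (((contDiff_const.mul ((hs 0 0).pow 3)).sub
      (contDiff_const.mul ((hs 0 0).mul (hs 1 1)))).add
      (contDiff_const.mul (((hs 0 0).mul (hs 1 3)).sub ((hs 0 1).mul (hs 1 2))))).sub
      (contDiff_const.mul ((hs 0 0).mul (hs 0 1)))
  · have l00 := h.tendsto_mixedD ht (j := 0) (k := 0) (by simp)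
    have l01 := h.tendsto_mixedD ht (j := 0) (k := 1) (by simp)
    have l11 := h.tendsto_mixedD ht (j := 1) (k := 1) (by simp)
    have l12 := h.tendsto_mixedD ht (j := 1) (k := 2) (by simp)
    have l13 := h.tendsto_mixedD ht (j := 1) (k := 3) (by simp)
    simpa using ((((l00.pow 3).const_mul (4 / 3)).sub ((l00.mul l11).const_mul (2 * β))).add
      (((l00.mul l13).sub (l01.mul l12)).const_mul (2 * β ^ 2))).sub
      ((l00.mul l01).const_mul (2 * ε))
  · intro s hs0 _ x
    have dt := fun j k => hasDerivAt_mixedD_time h.smooth j k s x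
    have dx := fun j k => hasDerivAt_mixedD_space h.smooth j k s x
    refine ⟨_, _, (((dt 0 0).pow 2).add (((dt 0 1).pow 2).const_mul β)).add
      (((dt 0 2).pow 2).const_mul (β ^ 2)),
      (((((dx 0 0).pow 3).const_mul (4 / 3)).sub (((dx 0 0).mul (dx 1 1)).const_mul (2 * β))).add
      ((((dx 0 0).mul (dx 1 3)).sub ((dx 0 1).mul (dx 1 2))).const_mul (2 * β ^ 2))).sub
      (((dx 0 0).mul (dx 0 1)).const_mul (2 * ε)), ?_⟩
    have hp := h.pde_mixedD hs0 x
    have hn : 0 ≤ 2 * ε * mixedD u 0 1 s x ^ 2 := by positivity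
    norm_num at hp ⊢
    linear_combination hn + 2 * mixedD u 0 0 s x * hp

lemma tendsto_atBot (h : IsAdmissibleRLW ε β u) {t : ℝ} (ht : 0 ≤ t) :
    Tendsto (fun x => mixedD u 0 0 t x) atBot (nhds 0) := by
  have h1 := h.tendsto_mixedD (T := t + 1) (by linarith) (j := 0) (k := 0) (by simp)
  refine h1.comp (g := fun p : ℝ × ℝ => mixedD u 0 0 p.1 p.2) (f := fun x => (t, x))
    (Tendsto.prodMk ?_ (tendsto_id.mono_right atBot_le_cocompact))
  exact tendsto_principal.2 (Eventually.of_forall fun _ => ⟨ht, by linarith⟩)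

lemma integral_energy_eq (h : IsAdmissibleRLW ε β u) {t : ℝ} (ht : 0 ≤ t) :
    ∫ x, (mixedD u 0 0 t x ^ 2 + β * mixedD u 0 1 t x ^ 2 + β ^ 2 * mixedD u 0 2 t x ^ 2) =
      (∫ x, mixedD u 0 0 t x ^ 2) + β * (∫ x, mixedD u 0 1 t x ^ 2)
        + β ^ 2 * ∫ x, mixedD u 0 2 t x ^ 2 := by
  have i0 := h.integrable_sq ht (j := 0) (k := 0) (by simp)
  have i1 := (h.integrable_sq ht (j := 0) (k := 1) (by simp)).const_mul β
  have i2 := (h.integrable_sq ht (j := 0) (k := 2) (by simp)).const_mul (β ^ 2)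
  have i01 : Integrable (fun x => mixedD u 0 0 t x ^ 2 + β * mixedD u 0 1 t x ^ 2) :=
    i0.add i1
  rw [integral_add i01 i2, integral_add i0 i1, integral_const_mul, integral_const_mul]

lemma sqrt_mul_sq_le (h : IsAdmissibleRLW ε β u) (hε : 0 < ε) (hβ : 0 < β) {C₀ : ℝ}
    (h0 : sqL2 (u 0) + β * sqL2 (fun x => mixedD u 0 1 0 x)
      + β ^ 2 * sqL2 (fun x => mixedD u 0 2 0 x) ≤ C₀) {t : ℝ} (ht : 0 ≤ t) (x : ℝ) :
    √β * mixedD u 0 0 t x ^ 2 ≤ C₀ := by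
  have hE : (∫ x, mixedD u 0 0 t x ^ 2) + β * (∫ x, mixedD u 0 1 t x ^ 2)
      + β ^ 2 * ∫ x, mixedD u 0 2 t x ^ 2 ≤ C₀ := by
    have hE0 : (∫ x, mixedD u 0 0 0 x ^ 2) + β * (∫ x, mixedD u 0 1 0 x ^ 2)
        + β ^ 2 * ∫ x, mixedD u 0 2 0 x ^ 2 ≤ C₀ := by
      simpa [sqL2, mixedD] using h0
    rcases ht.eq_or_lt with rfl | ht'
    · exact hE0
    · have := h.energy_le hε ht'
      rw [h.integral_energy_eq ht, h.integral_energy_eq le_rfl] at this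
      linarith
  have hsob := mul_sq_le_integral_of_hasDerivAt (hasDerivAt_mixedD_space h.smooth 0 0 t)
    (continuous_mixedD_space h.smooth 0 1 t) (h.integrable_sq ht (by simp))
    (h.integrable_sq ht (by simp)) (h.tendsto_atBot ht) (√β) x
  rw [Real.sq_sqrt hβ.le] at hsob
  have : 0 ≤ β ^ 2 * ∫ x, mixedD u 0 2 t x ^ 2 :=
    mul_nonneg (by positivity) (integral_nonneg fun _ => by positivity)
  linarith

lemma integrable_pow_four (h : IsAdmissibleRLW ε β u) {t B : ℝ} (ht : 0 ≤ t)
    (hB : ∀ x, mixedD u 0 0 t x ^ 2 ≤ B) : Integrable (fun x => mixedD u 0 0 t x ^ 4) := by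
  have hc : Continuous (mixedD u 0 0 t) :=
    continuous_mixedD_space h.smooth 0 0 t
  refine ((h.integrable_sq ht (j := 0) (k := 0) (by simp)).const_mul B).mono' (by fun_prop)
    (Eventually.of_forall fun x => ?_)
  rw [Real.norm_of_nonneg (by positivity)]
  nlinarith [hB x, sq_nonneg (mixedD u 0 0 t x)]

lemma higher_energy_le (h : IsAdmissibleRLW ε β u) (hε : 0 < ε) (hβ : 0 < β)
    (hB : ∀ t, 0 ≤ t → ∀ x, β * mixedD u 0 0 t x ^ 2 ≤ ε ^ 2 / 8) {t : ℝ} (ht : 0 < t) :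
    (∫ x, mixedD u 0 0 t x ^ 4) + β * ε ^ 2 * ∫ x, mixedD u 0 2 t x ^ 2 ≤
      (∫ x, mixedD u 0 0 0 x ^ 4) + β * ε ^ 2 * ∫ x, mixedD u 0 2 0 x ^ 2 := by
  have hs := contDiff_mixedD h.smooth
  have i4 : ∀ s : ℝ, 0 ≤ s → Integrable (fun x => mixedD u 0 0 s x ^ 4) := fun s hs =>
    h.integrable_pow_four (B := ε ^ 2 / 8 / β) hs fun x => by
      rw [le_div_iff₀' hβ]; exact hB s hs x
  have i2 : ∀ s : ℝ, 0 ≤ s → Integrable (fun x => β * ε ^ 2 * mixedD u 0 2 s x ^ 2) :=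
    fun s hs => (h.integrable_sq hs (by simp)).const_mul _
  rw [← integral_const_mul, ← integral_const_mul, ← integral_add (i4 t ht.le) (i2 t ht.le),
    ← integral_add (i4 0 le_rfl) (i2 0 le_rfl)]
  refine integral_le_of_divergence_nonpos
    (e := fun p => mixedD u 0 0 p.1 p.2 ^ 4 + β * ε ^ 2 * mixedD u 0 2 p.1 p.2 ^ 2)
    (q := fun p => 8 / 5 * mixedD u 0 0 p.1 p.2 ^ 5
      - 4 * β * (mixedD u 0 0 p.1 p.2 ^ 3 * mixedD u 1 1 p.1 p.2)
      + 4 * β ^ 2 * (mixedD u 0 0 p.1 p.2 ^ 3 * mixedD u 1 3 p.1 p.2)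
      - 4 * ε * (mixedD u 0 0 p.1 p.2 ^ 3 * mixedD u 0 1 p.1 p.2)
      - 2 * β * ε * (mixedD u 1 0 p.1 p.2 * mixedD u 1 1 p.1 p.2)
      - 2 * β ^ 3 * ε * (mixedD u 1 3 p.1 p.2 * mixedD u 1 2 p.1 p.2))
    ?_ ?_ ht.le ?_ ?_ ((i4 0 le_rfl).add (i2 0 le_rfl)) ((i4 t ht.le).add (i2 t ht.le))
  · exact ((hs 0 0).pow 4).add (contDiff_const.mul ((hs 0 2).pow 2))
  · exact (((((contDiff_const.mul ((hs 0 0).pow 5)).sub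
      (contDiff_const.mul (((hs 0 0).pow 3).mul (hs 1 1)))).add
      (contDiff_const.mul (((hs 0 0).pow 3).mul (hs 1 3)))).sub
      (contDiff_const.mul (((hs 0 0).pow 3).mul (hs 0 1)))).sub
      (contDiff_const.mul ((hs 1 0).mul (hs 1 1)))).sub
      (contDiff_const.mul ((hs 1 3).mul (hs 1 2)))
  · have l00 := h.tendsto_mixedD ht (j := 0) (k := 0) (by simp)
    have l01 := h.tendsto_mixedD ht (j := 0) (k := 1) (by simp)
    have l10 := h.tendsto_mixedD ht (j := 1) (k := 0) (by simp)
    have l11 := h.tendsto_mixedD ht (j := 1) (k := 1) (by simp)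
    have l12 := h.tendsto_mixedD ht (j := 1) (k := 2) (by simp)
    have l13 := h.tendsto_mixedD ht (j := 1) (k := 3) (by simp)
    simpa using ((((((l00.pow 5).const_mul (8 / 5)).sub
      (((l00.pow 3).mul l11).const_mul (4 * β))).add
      (((l00.pow 3).mul l13).const_mul (4 * β ^ 2))).sub
      (((l00.pow 3).mul l01).const_mul (4 * ε))).sub
      ((l10.mul l11).const_mul (2 * β * ε))).sub
      ((l13.mul l12).const_mul (2 * β ^ 3 * ε))
  · intro s hs0 _ x
    have dt := fun j k => hasDerivAt_mixedD_time h.smooth j k s x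
    have dx := fun j k => hasDerivAt_mixedD_space h.smooth j k s x
    refine ⟨_, _, ((dt 0 0).pow 4).add (((dt 0 2).pow 2).const_mul (β * ε ^ 2)),
      (((((((dx 0 0).pow 5).const_mul (8 / 5)).sub
      ((((dx 0 0).pow 3).mul (dx 1 1)).const_mul (4 * β))).add
      ((((dx 0 0).pow 3).mul (dx 1 3)).const_mul (4 * β ^ 2))).sub
      ((((dx 0 0).pow 3).mul (dx 0 1)).const_mul (4 * ε))).sub
      (((dx 1 0).mul (dx 1 1)).const_mul (2 * β * ε))).sub
      (((dx 1 3).mul (dx 1 2)).const_mul (2 * β ^ 3 * ε)), ?_⟩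
    have hp := h.pde_mixedD hs0 x
    have hn := dissipation_nonpos (b := mixedD u 0 1 s x) (r := mixedD u 1 1 s x)
      (s := mixedD u 1 2 s x) (w := mixedD u 1 3 s x) hε hβ (hB s hs0.le x)
    norm_num at hp hn ⊢
    linear_combination hn + (4 * mixedD u 0 0 s x ^ 3 - 2 * β * ε * mixedD u 1 2 s x) * hp

end IsAdmissibleRLW

/-- Uniform bound `√β ε ‖∂ₓ²u(t,·)‖_{L²} ≤ C` for the Rosenau–RLW
approximation (★★). -/
theorem uxx_bound_RLW (C0 : ℝ) (hC0 : 0 < C0) :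
    ∃ D : ℝ, 0 < D ∧ ∃ C : ℝ, 0 < C ∧
      ∀ ε β : ℝ, 0 < ε → 0 < β → β ≤ D ^ 2 * ε ^ 4 →
        ∀ u : ℝ → ℝ → ℝ, IsAdmissibleRLW ε β u →
          DataBoundsRLW ε β C0 (u 0) →
          (sqL2 (u 0) + β * sqL2 (fun x => mixedD u 0 1 0 x)
            + β ^ 2 * sqL2 (fun x => mixedD u 0 2 0 x) ≤ C0) →
          ∀ t > (0 : ℝ),
            Real.sqrt β * ε * nL2 (fun x => mixedD u 0 2 t x) ≤ C := by
  refine ⟨1 / (8 * C0), by positivity, √C0, Real.sqrt_pos.2 hC0, ?_⟩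
  intro ε β hε hβ hβε u hu hdata h0 t ht
  have hsqrt : √β ≤ 1 / (8 * C0) * ε ^ 2 :=
    (Real.sqrt_le_left (by positivity)).2 (hβε.trans_eq (by ring))
  have hB : ∀ t, 0 ≤ t → ∀ x, β * mixedD u 0 0 t x ^ 2 ≤ ε ^ 2 / 8 := by
    intro t ht x
    calc β * mixedD u 0 0 t x ^ 2 = √β * (√β * mixedD u 0 0 t x ^ 2) := by
          rw [← mul_assoc, Real.mul_self_sqrt hβ.le]
      _ ≤ √β * C0 :=
          mul_le_mul_of_nonneg_left (hu.sqrt_mul_sq_le hε hβ h0 ht x) (Real.sqrt_nonneg β)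
      _ ≤ 1 / (8 * C0) * ε ^ 2 * C0 := mul_le_mul_of_nonneg_right hsqrt hC0.le
      _ = ε ^ 2 / 8 := by field_simp
  have hfin := hu.higher_energy_le hε hβ hB ht
  have hdata' : (∫ x, mixedD u 0 0 0 x ^ 4) + β * ε ^ 2 * ∫ x, mixedD u 0 2 0 x ^ 2 ≤ C0 := by
    have h2 : 0 ≤ ∫ x, u 0 x ^ 2 := integral_nonneg fun _ => by positivity
    have hd : (∫ x, u 0 x ^ 2) + (∫ x, mixedD u 0 0 0 x ^ 4)
        + β * ε ^ 2 * (∫ x, mixedD u 0 2 0 x ^ 2) ≤ C0 := by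
      simpa [DataBoundsRLW, mixedD] using hdata
    linarith
  have h4 : 0 ≤ ∫ x, mixedD u 0 0 t x ^ 4 := integral_nonneg fun _ => by positivity
  refine Real.le_sqrt_of_sq_le ?_
  rw [nL2, mul_pow, mul_pow, Real.sq_sqrt hβ.le,
    Real.sq_sqrt (integral_nonneg fun _ => by positivity)]
  linarith

end
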